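/- arXiv:2306.14396 — 7 statements merged into one kernel-verified Lean document; each statement's English description precedes it below -/
import Mathlib

section
/- Let L be a modular lattice and let x₀, x₀', A, B be elements of L such that x₀ ⊓ x₀' ≤ B and A ≤ x₀ ⊔ x₀'. Then A ≤ x₀' ⊔ (x₀ ⊓ B) if and only if x₀ ⊓ (x₀' ⊔ A) ≤ B. -/
/-- **Lemma (ABx).** In a modular lattice, if `x₀ ⊓ x₀' ≤ B` and `A ≤ x₀ ⊔ x₀'`,
then `A ≤ x₀' ⊔ (x₀ ⊓ B)` if and only if `x₀ ⊓ (x₀' ⊔ A) ≤ B`. -/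
theorem stmt_0 {L : Type*} [Lattice L] [IsModularLattice L]
    (x₀ x₀' A B : L) (h₁ : x₀ ⊓ x₀' ≤ B) (h₂ : A ≤ x₀ ⊔ x₀') :
    A ≤ x₀' ⊔ (x₀ ⊓ B) ↔ x₀ ⊓ (x₀' ⊔ A) ≤ B := by
  constructor
  · intro h
    calc x₀ ⊓ (x₀' ⊔ A) ≤ x₀ ⊓ (x₀' ⊔ x₀ ⊓ B) := inf_le_inf_left _ (sup_le le_sup_left h)
      _ ≤ x₀ ⊓ x₀' ⊔ x₀ ⊓ B := inf_sup_le_assoc_of_le x₀' inf_le_left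
      _ ≤ B := sup_le h₁ inf_le_right
  · intro h
    calc A ≤ (x₀' ⊔ x₀) ⊓ (x₀' ⊔ A) := le_inf (h₂.trans_eq (sup_comm _ _)) le_sup_right
      _ ≤ x₀' ⊔ x₀ ⊓ (x₀' ⊔ A) := sup_inf_le_assoc_of_le x₀ le_sup_left
      _ ≤ x₀' ⊔ x₀ ⊓ B := sup_le_sup_left (le_inf inf_le_left h) _
end

section
/- Let L be a lattice and n ≥ 3 an integer. Then L satisfies the inequality (Dₙ) for all families x, x' : ZMod n → L if and only if L satisfies the inequality (Dₙ*) for all families x, x' : ZMod n → L. -/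
/-- The Haiman inequality (Dₙ): with `yᵢ = (xᵢ ⊔ xᵢ₊₁) ⊓ (x'ᵢ ⊔ x'ᵢ₊₁)` (indices mod `n`),
`x₀ ⊓ (x'₀ ⊔ ⨅_{i=1}^{n-1} (xᵢ ⊔ x'ᵢ)) ≤ x₁ ⊔ ((x'₀ ⊔ x'₁) ⊓ ⨆_{i=1}^{n-1} yᵢ)`. -/
def DnIneq {L : Type*} [Lattice L] (n : ℕ) (hn : 3 ≤ n) (x x' : ZMod n → L) : Prop :=
  x 0 ⊓ (x' 0 ⊔ (Finset.Icc 1 (n - 1)).inf' (Finset.nonempty_Icc.mpr (by omega))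
      (fun i : ℕ => x (i : ZMod n) ⊔ x' (i : ZMod n))) ≤
    x 1 ⊔ ((x' 0 ⊔ x' 1) ⊓ (Finset.Icc 1 (n - 1)).sup' (Finset.nonempty_Icc.mpr (by omega))
      (fun i : ℕ => (x (i : ZMod n) ⊔ x ((i : ZMod n) + 1)) ⊓
               (x' (i : ZMod n) ⊔ x' ((i : ZMod n) + 1))))

/-- The Haiman inequality (Dₙ*): with `yᵢ = (xᵢ ⊔ xᵢ₊₁) ⊓ (x'ᵢ ⊔ x'ᵢ₊₁)` (indices mod `n`),
`⨅_{i=0}^{n-1} (xᵢ ⊔ x'ᵢ) ≤ x'₀ ⊔ (x₀ ⊓ (x₁ ⊔ ((x'₀ ⊔ x'₁) ⊓ ⨆_{i=1}^{n-1} yᵢ)))`. -/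
def DnStarIneq {L : Type*} [Lattice L] (n : ℕ) (hn : 3 ≤ n) (x x' : ZMod n → L) : Prop :=
  (Finset.Icc 0 (n - 1)).inf' (Finset.nonempty_Icc.mpr (by omega))
      (fun i : ℕ => x (i : ZMod n) ⊔ x' (i : ZMod n)) ≤
    x' 0 ⊔ (x 0 ⊓ (x 1 ⊔ ((x' 0 ⊔ x' 1) ⊓ (Finset.Icc 1 (n - 1)).sup'
      (Finset.nonempty_Icc.mpr (by omega))
      (fun i : ℕ => (x (i : ZMod n) ⊔ x ((i : ZMod n) + 1)) ⊓
               (x' (i : ZMod n) ⊔ x' ((i : ZMod n) + 1))))))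

section Haiman

variable {L : Type*} [Lattice L] {n : ℕ}

theorem isModularLattice_of_forall_DnIneq (hn : 3 ≤ n)
    (h : ∀ x x' : ZMod n → L, DnIneq n hn x x') : IsModularLattice L := by
  have : Fact (1 < n) := ⟨by omega⟩
  refine ⟨fun {c} b {a} hca => ?_⟩
  let x : ZMod n → L := fun i => if i = 0 then a else c
  have hx (i : ZMod n) : c ≤ x i ∧ x i ≤ a := by
    by_cases hi : i = 0 <;> simp [x, hi, hca]
  have hD := h x (fun _ => b)
  have hx0 : x 0 = a := by simp [x]
  have hx1 : x 1 = c := by simp [x]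
  simp only [DnIneq, hx0, hx1, sup_idem] at hD
  calc (c ⊔ b) ⊓ a ≤ _ := by
        rw [inf_comm, sup_comm]
        gcongr
        exact Finset.le_inf' _ _ fun i _ => (hx _).1.trans le_sup_left
    _ ≤ _ := hD
    _ ≤ c ⊔ b ⊓ a := by
        gcongr
        exact Finset.sup'_le _ _ fun i _ => inf_le_left.trans (sup_le (hx _).2 (hx _).2)

theorem isModularLattice_of_forall_DnStarIneq (hn : 3 ≤ n)
    (h : ∀ x x' : ZMod n → L, DnStarIneq n hn x x') : IsModularLattice L := by
  have : Fact (1 < n) := ⟨by omega⟩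
  refine ⟨fun {b} a {d} hbd => ?_⟩
  let x : ZMod n → L := fun i => if i = 0 then a else d
  have hD := h x (fun _ => b)
  have hx0 : x 0 = a := by simp [x]
  have hx1 : x 1 = d := by simp [x]
  simp only [DnStarIneq, hx0, hx1, sup_idem] at hD
  calc (b ⊔ a) ⊓ d ≤ _ := by
        refine Finset.le_inf' _ _ fun i _ => ?_
        by_cases hi : (i : ZMod n) = 0
        · simp [x, hi, sup_comm]
        · simp [x, hi]
    _ ≤ _ := hD
    _ ≤ b ⊔ a ⊓ d := by
        gcongr
        exact sup_le le_rfl (inf_le_left.trans hbd)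

theorem DnIneq.dnStarIneq [IsModularLattice L] {hn : 3 ≤ n} {x x' : ZMod n → L}
    (h : DnIneq n hn x x') : DnStarIneq n hn x x' := by
  unfold DnIneq at h
  unfold DnStarIneq
  refine le_trans ?_ (sup_le_sup_left (le_inf inf_le_left h) _)
  rw [← sup_inf_assoc_of_le _ le_sup_left]
  refine le_inf ?_ (le_trans ?_ le_sup_right)
  · refine (Finset.inf'_le _ (Finset.mem_Icc.mpr ⟨le_rfl, Nat.zero_le _⟩)).trans ?_
    simp [sup_comm]
  · exact Finset.inf'_mono _ (Finset.Icc_subset_Icc_left (Nat.zero_le 1)) _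

theorem dnIneq_of_forall_DnStarIneq [IsModularLattice L] (hn : 3 ≤ n)
    (h : ∀ x x' : ZMod n → L, DnStarIneq n hn x x') (x x' : ZMod n → L) :
    DnIneq n hn x x' := by
  have : Fact (1 < n) := ⟨by omega⟩
  unfold DnIneq
  set m := (Finset.Icc 1 (n - 1)).inf' (Finset.nonempty_Icc.mpr (by omega))
      (fun i : ℕ => x (i : ZMod n) ⊔ x' (i : ZMod n))
  set R := x 1 ⊔ ((x' 0 ⊔ x' 1) ⊓ (Finset.Icc 1 (n - 1)).sup' (Finset.nonempty_Icc.mpr (by omega))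
      (fun i : ℕ => (x (i : ZMod n) ⊔ x ((i : ZMod n) + 1)) ⊓
               (x' (i : ZMod n) ⊔ x' ((i : ZMod n) + 1)))) with hR
  set a := x 0 ⊓ (x' 0 ⊔ m)
  let z : ZMod n → L := Function.update x 0 a
  have hz0 : z 0 = a := by simp [z]
  have hz1 : z 1 = x 1 := by simp [z]
  have hzx (i : ZMod n) : z i ≤ x i := by
    by_cases hi : i = 0
    · subst hi
      exact hz0.le.trans inf_le_left
    · simp [z, hi]
  have hstar : (a ⊔ x' 0) ⊓ m ≤ x' 0 ⊔ a ⊓ R := by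
    have hD := h z x'
    simp only [DnStarIneq, hz0, hz1] at hD
    calc (a ⊔ x' 0) ⊓ m ≤ _ := by
          refine Finset.le_inf' _ _ fun i hi => ?_
          by_cases hi0 : (i : ZMod n) = 0
          · simp only [hi0, hz0]
            exact inf_le_left
          · have hi' : i ∈ Finset.Icc 1 (n - 1) := by
              refine Finset.mem_Icc.mpr ⟨Nat.one_le_iff_ne_zero.mpr ?_, (Finset.mem_Icc.mp hi).2⟩
              rintro rfl
              simp at hi0
            have hzi : z i = x i := by simp [z, hi0]
            rw [hzi]
            exact inf_le_right.trans (Finset.inf'_le _ hi')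
      _ ≤ _ := hD
      _ ≤ x' 0 ⊔ a ⊓ R := by
          rw [hR]
          gcongr <;> exact hzx _
  have hab : a ⊓ x' 0 ≤ R := by
    refine le_sup_of_le_right (le_inf (inf_le_right.trans le_sup_left) ?_)
    have hlast : ((n - 1 : ℕ) : ZMod n) + 1 = 0 := by
      rw [← Nat.cast_add_one, Nat.sub_add_cancel (by omega), ZMod.natCast_self]
    refine le_trans ?_ (Finset.le_sup' _ (Finset.mem_Icc.mpr ⟨by omega, le_refl (n - 1)⟩))
    simp only [hlast]
    exact inf_le_inf (inf_le_left.trans le_sup_right) le_sup_right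
  have hjoin : a ≤ a ⊓ R ⊔ x' 0 := by
    calc a ≤ (x' 0 ⊔ m) ⊓ (a ⊔ x' 0) := le_inf inf_le_right le_sup_left
      _ = x' 0 ⊔ m ⊓ (a ⊔ x' 0) := sup_inf_assoc_of_le _ le_sup_right
      _ ≤ a ⊓ R ⊔ x' 0 := sup_le le_sup_right (by rwa [inf_comm, sup_comm (a ⊓ R)])
  calc a ≤ (a ⊓ R ⊔ x' 0) ⊓ a := le_inf hjoin le_rfl
    _ = a ⊓ R ⊔ x' 0 ⊓ a := sup_inf_assoc_of_le _ inf_le_left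
    _ ≤ R := sup_le inf_le_right (by rwa [inf_comm])

end Haiman

/-- A lattice satisfies (Dₙ) for all families `x, x' : ZMod n → L` iff it satisfies
(Dₙ*) for all such families. -/
theorem stmt_2 {L : Type*} [Lattice L] (n : ℕ) (hn : 3 ≤ n) :
    (∀ x x' : ZMod n → L, DnIneq n hn x x') ↔ (∀ x x' : ZMod n → L, DnStarIneq n hn x x') := by
  constructor
  · intro h x x'
    have := isModularLattice_of_forall_DnIneq hn h
    exact (h x x').dnStarIneq
  · intro h
    have := isModularLattice_of_forall_DnStarIneq hn h
    exact dnIneq_of_forall_DnStarIneq hn h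
end

section
/- Let L be a modular lattice, n ≥ 3 an integer, and x, x' : ZMod n → L. Then the inequality (Dₙ) holds for x, x' if and only if the inequality (Dₙ*) holds for x, x'. -/
theorem inf_sup_le_iff_sup_inf_le {L : Type*} [Lattice L] [IsModularLattice L] {a b c r : L}
    (hr : a ⊓ b ≤ r) : a ⊓ (b ⊔ c) ≤ r ↔ (a ⊔ b) ⊓ c ≤ b ⊔ (a ⊓ r) := by
  constructor
  · intro h
    calc (a ⊔ b) ⊓ c ≤ (b ⊔ a) ⊓ (b ⊔ c) :=
          le_inf (inf_le_left.trans (sup_comm a b).le) (inf_le_right.trans le_sup_right)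
      _ = b ⊔ a ⊓ (b ⊔ c) := sup_inf_assoc_of_le a le_sup_left
      _ ≤ b ⊔ a ⊓ r := sup_le_sup_left (le_inf inf_le_left h) b
  · intro h
    calc a ⊓ (b ⊔ c) ≤ (a ⊓ r ⊔ b) ⊓ a := by
          refine le_inf ?_ inf_le_left
          calc a ⊓ (b ⊔ c) ≤ (b ⊔ c) ⊓ (a ⊔ b) :=
                le_inf inf_le_right (inf_le_left.trans le_sup_left)
            _ = b ⊔ c ⊓ (a ⊔ b) := sup_inf_assoc_of_le c le_sup_right
            _ ≤ a ⊓ r ⊔ b :=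
                sup_le le_sup_right ((inf_comm _ _).le.trans (h.trans (sup_comm _ _).le))
      _ = a ⊓ r ⊔ b ⊓ a := sup_inf_assoc_of_le b inf_le_left
      _ ≤ r := sup_le inf_le_right (by rwa [inf_comm])

/-- In a modular lattice, for any fixed families `x, x' : ZMod n → L`, the inequality
(Dₙ) holds for `x, x'` iff (Dₙ*) holds for `x, x'`. -/
theorem stmt_3 {L : Type*} [Lattice L] [IsModularLattice L] (n : ℕ) (hn : 3 ≤ n)
    (x x' : ZMod n → L) : DnIneq n hn x x' ↔ DnStarIneq n hn x x' := by
  have hIcc : Finset.Icc 0 (n - 1) = insert 0 (Finset.Icc 1 (n - 1)) := by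
    ext i
    simp only [Finset.mem_Icc, Finset.mem_insert]
    omega
  have hne : (Finset.Icc 1 (n - 1)).Nonempty := Finset.nonempty_Icc.mpr (by omega)
  have hlast : ((n - 1 : ℕ) : ZMod n) + 1 = 0 := by
    rw [← Nat.cast_add_one, Nat.sub_add_cancel (by omega), ZMod.natCast_self]
  have hy : x 0 ⊓ x' 0 ≤ (Finset.Icc 1 (n - 1)).sup' hne
      (fun i : ℕ => (x (i : ZMod n) ⊔ x ((i : ZMod n) + 1)) ⊓
               (x' (i : ZMod n) ⊔ x' ((i : ZMod n) + 1))) := by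
    refine Finset.le_sup'_of_le _ (Finset.mem_Icc.mpr ⟨by omega, le_refl (n - 1)⟩) ?_
    rw [hlast]
    exact inf_le_inf le_sup_right le_sup_right
  have hinf : (Finset.Icc 0 (n - 1)).inf' (Finset.nonempty_Icc.mpr (by omega))
      (fun i : ℕ => x (i : ZMod n) ⊔ x' (i : ZMod n)) =
      (x 0 ⊔ x' 0) ⊓ (Finset.Icc 1 (n - 1)).inf' hne
        (fun i : ℕ => x (i : ZMod n) ⊔ x' (i : ZMod n)) := by
    simp only [hIcc, Finset.inf'_insert hne, Nat.cast_zero]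
  unfold DnIneq DnStarIneq
  rw [hinf]
  exact inf_sup_le_iff_sup_inf_le
    (le_sup_of_le_right (le_inf (inf_le_right.trans le_sup_left) hy))
end

section
/- Let L be a lattice and n ≥ 3 an integer. If the inequality (Dₙ*) holds in L for all families x, x' : ZMod n → L, then L is modular. -/
/-- If (Dₙ*) holds in a lattice `L` for all families `x, x' : ZMod n → L`, then `L`
is modular. -/
theorem stmt_4 {L : Type*} [Lattice L] (n : ℕ) (hn : 3 ≤ n)
    (h : ∀ x x' : ZMod n → L, DnStarIneq n hn x x') : IsModularLattice L := by
  refine ⟨fun {a} b {c} hac => ?_⟩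
  have : Fact (1 < n) := ⟨by omega⟩
  have key := h (fun i => if i = 0 then b else c) (fun _ => a)
  simp only [DnStarIneq, if_true, one_ne_zero, if_false] at key
  refine (Finset.le_inf' _ _ fun i _ => ?_).trans (key.trans ?_)
  · split_ifs
    · exact inf_le_left.trans_eq (sup_comm a b)
    · exact inf_le_right.trans le_sup_left
  · gcongr
    exact sup_le le_rfl (inf_le_left.trans (sup_le hac hac))
end

section
/- Let L be a lattice and n ≥ 3 an integer. If the inequality (Dₙ) holds in L for all families x, x' : ZMod n → L, then L is modular. -/
/-- If (Dₙ) holds in a lattice `L` for all families `x, x' : ZMod n → L`, then `L`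
is modular. -/
theorem stmt_5 {L : Type*} [Lattice L] (n : ℕ) (hn : 3 ≤ n)
    (h : ∀ x x' : ZMod n → L, DnIneq n hn x x') : IsModularLattice L := by
  refine ⟨fun {a} b {c} hac => ?_⟩
  have : Fact (1 < n) := ⟨by omega⟩
  have hle : ∀ i : ZMod n, (if i = 0 then c else a) ≤ c := fun i => by
    split_ifs
    exacts [le_rfl, hac]
  have hge : ∀ i : ZMod n, a ≤ if i = 0 then c else a := fun i => by
    split_ifs
    exacts [hac, le_rfl]
  have key := h (fun i => if i = 0 then c else a) (fun _ => b)
  simp only [DnIneq, if_true, one_ne_zero, if_false, sup_idem] at key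
  calc (a ⊔ b) ⊓ c ≤ _ := le_inf inf_le_right (inf_le_left.trans ?_)
    _ ≤ _ := key
    _ ≤ a ⊔ b ⊓ c := sup_le_sup_left (inf_le_inf_left b ?_) a
  · exact sup_le (le_sup_of_le_right (Finset.le_inf' _ _ fun i _ => (hge _).trans le_sup_left))
      le_sup_left
  · exact Finset.sup'_le _ _ fun i _ => inf_le_left.trans (sup_le (hle _) (hle _))
end

section
/- Let A be a type, n ≥ 3 an integer, and let α, α' : ZMod n → Setoid A be families of equivalence relations on A such that for every i the relations of α i and α' i permute, i.e., for all a, b ∈ A, (∃ c, (α i).Rel a c ∧ (α' i).Rel c b) ↔ (∃ c, (α' i).Rel a c ∧ (α i).Rel c b). Then the inequality (Dₙ*) holds in the lattice Setoid A with α i substituted for xᵢ and α' i for x'ᵢ: ⨅_{i=0}^{n-1}(α i ⊔ α' i) ≤ α' 0 ⊔ (α 0 ⊓ (α 1 ⊔ ((α' 0 ⊔ α' 1) ⊓ ⨆_{i=1}^{n-1} γᵢ))), where γᵢ = (α i ⊔ α (i+1)) ⊓ (α' i ⊔ α' (i+1)). -/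
/-- The join of two permuting equivalence relations is contained in their composition. -/
theorem Setoid.exists_of_sup_of_permute {A : Type*} {r s : Setoid A}
    (h : ∀ a b, (∃ c, r a c ∧ s c b) ↔ (∃ c, s a c ∧ r c b)) {a b : A} (hab : (r ⊔ s) a b) :
    ∃ c, s a c ∧ r c b := by
  let t : Setoid A :=
    { r := fun a b => ∃ c, s a c ∧ r c b
      iseqv :=
        { refl := fun a => ⟨a, s.refl' a, r.refl' a⟩
          symm := fun {a b} ⟨c, hac, hcb⟩ => (h b a).1 ⟨c, r.symm' hcb, s.symm' hac⟩
          trans := fun {a b d} ⟨c, hac, hcb⟩ ⟨e, hbe, hed⟩ => by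
            obtain ⟨f, hcf, hfe⟩ := (h c e).1 ⟨b, hcb, hbe⟩
            exact ⟨f, s.trans' hac hcf, r.trans' hfe hed⟩ } }
  have hr : r ≤ t := fun {a b} hab => ⟨a, s.refl' a, hab⟩
  have hs : s ≤ t := fun {a b} hab => ⟨b, hab, r.refl' b⟩
  exact (sup_le hr hs : r ⊔ s ≤ t) hab

/-- The composition of two equivalence relations is contained in their join. -/
theorem Setoid.sup_of_rel_rel {A : Type*} {r s : Setoid A} {a b c : A}
    (hac : r a c) (hcb : s c b) : (r ⊔ s) a b :=
  (r ⊔ s).trans' ((le_sup_left : r ≤ r ⊔ s) hac) ((le_sup_right : s ≤ r ⊔ s) hcb)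

/-- If `α i` and `α' i` are pairwise permuting equivalence relations on a set `A`
(indices in `ZMod n`, `n ≥ 3`), then the instance of the inequality (Dₙ*) obtained by
substituting `α i` for `xᵢ` and `α' i` for `x'ᵢ` holds in the lattice `Setoid A`, where
`γᵢ = (α i ⊔ α (i+1)) ⊓ (α' i ⊔ α' (i+1))`. -/
theorem stmt_6 {A : Type*} (n : ℕ) (hn : 3 ≤ n) (α α' : ZMod n → Setoid A)
    (hperm : ∀ i : ZMod n, ∀ a b : A,
      (∃ c, α i a c ∧ α' i c b) ↔ (∃ c, α' i a c ∧ α i c b)) :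
    (Finset.Icc 0 (n - 1)).inf' (Finset.nonempty_Icc.mpr (by omega))
        (fun i : ℕ => α (i : ZMod n) ⊔ α' (i : ZMod n)) ≤
      α' 0 ⊔ (α 0 ⊓ (α 1 ⊔ ((α' 0 ⊔ α' 1) ⊓ (Finset.Icc 1 (n - 1)).sup'
        (Finset.nonempty_Icc.mpr (by omega))
        (fun i : ℕ => (α (i : ZMod n) ⊔ α ((i : ZMod n) + 1)) ⊓
                 (α' (i : ZMod n) ⊔ α' ((i : ZMod n) + 1)))))) := by
  have : NeZero n := ⟨by omega⟩
  intro a b hab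
  have hjoin : ∀ i : ZMod n, ∃ c, α' i a c ∧ α i c b := by
    intro i
    refine Setoid.exists_of_sup_of_permute (hperm i) ?_
    have hi : i.val ∈ Finset.Icc 0 (n - 1) := by
      have := ZMod.val_lt i
      simp only [Finset.mem_Icc]
      omega
    have hle := Finset.inf'_le (fun i : ℕ => α (i : ZMod n) ⊔ α' (i : ZMod n)) hi
    simp only [ZMod.natCast_zmod_val] at hle
    exact hle hab
  choose c hac hcb using hjoin
  let S := (Finset.Icc 1 (n - 1)).sup' (Finset.nonempty_Icc.mpr (by omega))
    (fun i : ℕ => (α (i : ZMod n) ⊔ α ((i : ZMod n) + 1)) ⊓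
      (α' (i : ZMod n) ⊔ α' ((i : ZMod n) + 1)))
  have hstep : ∀ i : ℕ, 1 ≤ i → i ≤ n - 1 → S (c i) (c ((i + 1 : ℕ) : ZMod n)) := by
    intro i h1 h2
    have hle := Finset.le_sup' (fun i : ℕ => (α (i : ZMod n) ⊔ α ((i : ZMod n) + 1)) ⊓
      (α' (i : ZMod n) ⊔ α' ((i : ZMod n) + 1))) (Finset.mem_Icc.mpr ⟨h1, h2⟩)
    rw [Nat.cast_succ]
    exact hle ⟨Setoid.sup_of_rel_rel (hcb _) ((α _).symm' (hcb _)),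
      Setoid.sup_of_rel_rel ((α' _).symm' (hac _)) (hac _)⟩
  have hchain : ∀ m : ℕ, 1 ≤ m → m ≤ n → S (c 1) (c (m : ZMod n)) := by
    intro m hm
    induction m, hm using Nat.le_induction with
    | base =>
      intro _
      rw [Nat.cast_one]
    | succ k hk ih =>
      intro hkn
      exact S.trans' (ih (by omega)) (hstep k hk (by omega))
  have hcycle : S (c 0) (c 1) := by
    have h := hchain n (by omega) le_rfl
    rw [ZMod.natCast_self] at h
    exact S.symm' h
  refine Setoid.sup_of_rel_rel (hac 0) ⟨hcb 0, ?_⟩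
  rw [sup_comm]
  exact Setoid.sup_of_rel_rel
    ⟨Setoid.sup_of_rel_rel ((α' 0).symm' (hac 0)) (hac 1), hcycle⟩ (hcb 1)
end

section
/- Let L be a modular lattice and let a, b, c ∈ L. With a' = a ⊓ (b ⊔ c), b' = b ⊔ (a ⊓ c), c' = c ⊔ (a ⊓ b), define a'' = a' ⊔ (b' ⊓ c'), b'' = b' ⊓ (a' ⊔ c'), c'' = c' ⊓ (a' ⊔ b'). Then the pairwise meets of a'', b'', c'' are all equal (a'' ⊓ b'' = b'' ⊓ c'' = a'' ⊓ c'') and the pairwise joins of a'', b'', c'' are all equal (a'' ⊔ b'' = b'' ⊔ c'' = a'' ⊔ c''); that is, a'', b'', c'' satisfy the defining relations of atoms of the diamond M₃. -/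
/-- In a modular lattice, `(b ⊔ a ⊓ c) ⊓ (c ⊔ a ⊓ b)` is the lower median of `a`, `b`, `c`. -/
theorem sup_inf_inf_sup_inf_eq {L : Type*} [Lattice L] [IsModularLattice L] (a b c : L) :
    (b ⊔ a ⊓ c) ⊓ (c ⊔ a ⊓ b) = a ⊓ b ⊔ b ⊓ c ⊔ a ⊓ c := by
  have hab : a ⊓ b ≤ b ⊔ a ⊓ c := inf_le_right.trans le_sup_left
  have hac : a ⊓ c ≤ c := inf_le_right
  rw [← inf_sup_assoc_of_le c hab, inf_comm (b ⊔ a ⊓ c) c, inf_comm c, sup_comm b,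
    sup_inf_assoc_of_le b hac]
  ac_rfl

/-- In a modular lattice, `a ⊓ (b ⊔ c) ⊔ b ⊓ (a ⊔ c)` is the upper median of `a`, `b`, `c`. -/
theorem inf_sup_sup_inf_sup_eq {L : Type*} [Lattice L] [IsModularLattice L] (a b c : L) :
    a ⊓ (b ⊔ c) ⊔ b ⊓ (a ⊔ c) = (a ⊔ b) ⊓ (b ⊔ c) ⊓ (a ⊔ c) := by
  have hac : a ⊓ (b ⊔ c) ≤ a ⊔ c := inf_le_left.trans le_sup_left
  have hb : b ≤ b ⊔ c := le_sup_left
  rw [← sup_inf_assoc_of_le b hac, inf_comm a, inf_sup_assoc_of_le a hb]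
  ac_rfl

/-- The two forms of the projection of `a` into the interval between the medians agree. -/
theorem inf_sup_sup_inf_eq {L : Type*} [Lattice L] [IsModularLattice L] (a b c : L) :
    a ⊓ (b ⊔ c) ⊔ b ⊓ c = (a ⊔ b ⊓ c) ⊓ (b ⊔ c) := by
  have h : b ⊓ c ≤ b ⊔ c := inf_le_left.trans le_sup_left
  rw [inf_comm a, inf_sup_assoc_of_le a h, inf_comm]

theorem median_projection_inf {L : Type*} [Lattice L] [IsModularLattice L] (a b c : L) :
    (a ⊓ (b ⊔ c) ⊔ b ⊓ c) ⊓ (b ⊓ (a ⊔ c) ⊔ a ⊓ c) = a ⊓ b ⊔ b ⊓ c ⊔ a ⊓ c := by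
  have h₁ : a ⊔ b ⊓ c ≤ a ⊔ c := sup_le_sup_left inf_le_right a
  have h₂ : b ⊔ a ⊓ c ≤ b ⊔ c := sup_le_sup_left inf_le_right b
  rw [inf_sup_sup_inf_eq a, inf_sup_sup_inf_eq b, inf_inf_inf_comm, inf_comm (b ⊔ c),
    inf_inf_inf_comm, inf_eq_left.2 h₁, inf_eq_left.2 h₂, inf_comm a c, inf_comm b c,
    sup_inf_inf_sup_inf_eq c a b]
  ac_rfl

theorem median_projection_sup {L : Type*} [Lattice L] [IsModularLattice L] (a b c : L) :
    (a ⊓ (b ⊔ c) ⊔ b ⊓ c) ⊔ (b ⊓ (a ⊔ c) ⊔ a ⊓ c) = (a ⊔ b) ⊓ (b ⊔ c) ⊓ (a ⊔ c) := by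
  have h₁ : b ⊓ c ≤ b ⊓ (a ⊔ c) := inf_le_inf_left b le_sup_right
  have h₂ : a ⊓ c ≤ a ⊓ (b ⊔ c) := inf_le_inf_left a le_sup_right
  rw [← inf_sup_sup_inf_sup_eq]
  apply le_antisymm
  · exact sup_le (sup_le le_sup_left (h₁.trans le_sup_right))
      (sup_le le_sup_right (h₂.trans le_sup_left))
  · exact sup_le_sup le_sup_left le_sup_left

/-- Joining with `a ⊓ (b ⊔ c)` first does not change the projection of `b`. -/
theorem sup_inf_inf_sup_eq {L : Type*} [Lattice L] [IsModularLattice L] (a b c : L) :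
    (b ⊔ a ⊓ c) ⊓ (a ⊓ (b ⊔ c) ⊔ (c ⊔ a ⊓ b)) = b ⊓ (a ⊔ c) ⊔ a ⊓ c := by
  have h : a ⊓ b ≤ a ⊓ (b ⊔ c) := inf_le_inf_left a le_sup_left
  have hc : c ≤ b ⊔ c := le_sup_right
  have hb : b ⊔ a ⊓ c ≤ b ⊔ c := sup_le_sup_left inf_le_right b
  rw [sup_left_comm, sup_eq_left.2 h, sup_comm c, inf_comm a (b ⊔ c),
    inf_sup_assoc_of_le a hc, ← inf_assoc, inf_eq_left.2 hb, inf_sup_sup_inf_eq]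

/-- In a modular lattice, with `a' = a ⊓ (b ⊔ c)`, `b' = b ⊔ (a ⊓ c)`, `c' = c ⊔ (a ⊓ b)`
and `a'' = a' ⊔ (b' ⊓ c')`, `b'' = b' ⊓ (a' ⊔ c')`, `c'' = c' ⊓ (a' ⊔ b')`, the elements
`a''`, `b''`, `c''` have all pairwise meets equal and all pairwise joins equal; that is,
they satisfy the defining relations of the atoms of the diamond `M₃`. -/
theorem stmt_9 {L : Type*} [Lattice L] [IsModularLattice L] (a b c : L)
    (a' b' c' a'' b'' c'' : L)
    (ha' : a' = a ⊓ (b ⊔ c)) (hb' : b' = b ⊔ (a ⊓ c)) (hc' : c' = c ⊔ (a ⊓ b))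
    (ha'' : a'' = a' ⊔ (b' ⊓ c')) (hb'' : b'' = b' ⊓ (a' ⊔ c'))
    (hc'' : c'' = c' ⊓ (a' ⊔ b')) :
    (a'' ⊓ b'' = b'' ⊓ c'' ∧ b'' ⊓ c'' = a'' ⊓ c'') ∧
      (a'' ⊔ b'' = b'' ⊔ c'' ∧ b'' ⊔ c'' = a'' ⊔ c'') := by
  have ea : a'' = a ⊓ (b ⊔ c) ⊔ b ⊓ c := by
    have h₁ : a ⊓ b ≤ a ⊓ (b ⊔ c) := inf_le_inf_left a le_sup_left
    have h₂ : a ⊓ c ≤ a ⊓ (b ⊔ c) := inf_le_inf_left a le_sup_right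
    rw [ha'', ha', hb', hc', sup_inf_inf_sup_inf_eq, ← sup_assoc, ← sup_assoc,
      sup_eq_left.2 h₁, sup_eq_left.2 (h₂.trans le_sup_left)]
  have eb : b'' = b ⊓ (a ⊔ c) ⊔ a ⊓ c := by
    rw [hb'', ha', hb', hc', sup_inf_inf_sup_eq]
  have ec : c'' = c ⊓ (a ⊔ b) ⊔ a ⊓ b := by
    rw [hc'', ha', hb', hc', sup_comm b c, sup_inf_inf_sup_eq]
  have mab := median_projection_inf a b c
  have mbc := median_projection_inf b c a
  have mac := median_projection_inf a c b
  have jab := median_projection_sup a b c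
  have jbc := median_projection_sup b c a
  have jac := median_projection_sup a c b
  rw [← ea, ← eb] at mab jab
  rw [sup_comm c a, inf_comm c a, sup_comm b a, inf_comm b a, ← eb, ← ec] at mbc jbc
  rw [sup_comm c b, inf_comm c b, ← ea, ← ec] at mac jac
  rw [mab, mbc, mac, jab, jbc, jac]
  refine ⟨⟨?_, ?_⟩, ?_, ?_⟩ <;> ac_rfl
end
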